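/- In the setting of the projective-limit measure μ̂ associated to a strongly r-invariant probability measure μ, a filter m₀ ∈ L^∞(X), and h ≥ 0 with Rh = h (R the Ruelle operator with weight |m₀|²), suppose in addition that m₀ is non-singular, i.e., m₀ does not vanish on a set of positive μ-measure. Define U f = (m₀∘θ₀)·(f∘r̂) for f ∈ L²(X_∞(r), μ̂), π(g) f = (g∘θ₀)·f for g ∈ L^∞(X), and φ = 1 (the constant function). Then U is a unitary operator on L²(X_∞(r), μ̂) and (L²(X_∞(r), μ̂), U, π, φ) is the covariant system associated to m₀ and h: U π(g) U⁻¹ = π(g∘r), ⟨φ, π(g)φ⟩ = ∫_X g h dμ, Uφ = π(m₀)φ, and the closed span of {U⁻ⁿ π(g) φ : n ≥ 0, g ∈ L^∞(X)} is all of L²(X_∞(r), μ̂). Moreover, for every g ∈ L^∞(X_∞(r), μ̂), if M_g denotes multiplication by g, then U M_g U⁻¹ = M_{g∘r̂}. -/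

import Mathlib

open MeasureTheory
open scoped ENNReal InnerProductSpace

/-- The projective limit (solenoid) of the system `X ← X ← X ← ⋯` under `r`. -/
def Xinf {X : Type} (r : X → X) : Set (ℕ → X) := {x | ∀ n, r (x (n + 1)) = x n}

/-- Projection onto the `n`-th coordinate. -/
def theta {X : Type} (r : X → X) (n : ℕ) (xh : Xinf r) : X := (xh : ℕ → X) n

/-- The induced automorphism `r̂(x₀,x₁,…) = (r x₀, x₀, x₁, …)`. -/
def rhat {X : Type} (r : X → X) (xh : Xinf r) : Xinf r :=
  ⟨fun n => Nat.rec (r ((xh : ℕ → X) 0)) (fun k _ => (xh : ℕ → X) k) n, by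
    intro n
    cases n with
    | zero => rfl
    | succ k => exact xh.2 k⟩

/-- Bounded measurable real functions. -/
def BddMeasurable {Y : Type} [MeasurableSpace Y] (f : Y → ℝ) : Prop :=
  Measurable f ∧ ∃ C, ∀ x, |f x| ≤ C

/-- Bounded measurable complex functions. -/
def BddMeasC {Y : Type} [MeasurableSpace Y] (f : Y → ℂ) : Prop :=
  Measurable f ∧ ∃ C, ∀ x, ‖f x‖ ≤ C

/-- The averaging (transfer) operator `f ↦ (1/#r⁻¹(x)) Σ_{r(y)=x} f(y)`. -/
noncomputable def transfer {Y : Type} (r : Y → Y) (f : Y → ℝ) (x : Y) : ℝ :=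
  (Nat.card (r ⁻¹' {x}) : ℝ)⁻¹ * ∑' y : r ⁻¹' {x}, f y

/-- The Ruelle transfer operator with weight `W`. -/
noncomputable def ruelle {Y : Type} (r : Y → Y) (W : Y → ℝ) (f : Y → ℝ) (x : Y) : ℝ :=
  (Nat.card (r ⁻¹' {x}) : ℝ)⁻¹ * ∑' y : r ⁻¹' {x}, W y * f y

/-- Strong `r`-invariance of a measure. -/
def StronglyInvariant {Y : Type} [MeasurableSpace Y] (r : Y → Y) (μ : Measure Y) : Prop :=
  ∀ f : Y → ℝ, BddMeasurable f → ∫ x, f x ∂μ = ∫ x, transfer r f x ∂μ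


section Transfer

variable {X : Type} {r : X → X}

lemma transfer_const_add (hsur : Function.Surjective r) (hfin : ∀ x, (r ⁻¹' {x}).Finite)
    (f : X → ℝ) (c : ℝ) (x : X) :
    transfer r (fun y => f y + c) x = transfer r f x + c := by
  have : Finite (r ⁻¹' {x}) := hfin x
  have : Fintype (r ⁻¹' {x}) := Fintype.ofFinite _
  have hne : Nonempty (r ⁻¹' {x}) := by
    obtain ⟨y, hy⟩ := hsur x
    exact ⟨⟨y, hy⟩⟩
  have hc : (Nat.card (r ⁻¹' {x}) : ℝ) ≠ 0 := by
    exact_mod_cast Nat.card_pos.ne'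
  unfold transfer
  rw [tsum_fintype, tsum_fintype, Finset.sum_add_distrib, mul_add]
  congr 1
  rw [Finset.sum_const, Finset.card_univ, ← Nat.card_eq_fintype_card, nsmul_eq_mul]
  field_simp

lemma transfer_nonneg {f : X → ℝ} (hf : ∀ x, 0 ≤ f x) (x : X) : 0 ≤ transfer r f x :=
  mul_nonneg (by positivity) (tsum_nonneg fun y => hf y)

lemma transfer_mono (hfin : ∀ x, (r ⁻¹' {x}).Finite) {f g : X → ℝ} (hf : ∀ x, f x ≤ g x)
    (x : X) : transfer r f x ≤ transfer r g x := by
  have : Finite (r ⁻¹' {x}) := hfin x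
  have : Fintype (r ⁻¹' {x}) := Fintype.ofFinite _
  unfold transfer
  rw [tsum_fintype, tsum_fintype]
  exact mul_le_mul_of_nonneg_left (Finset.sum_le_sum fun i _ => hf i) (by positivity)

lemma transfer_tendsto (hfin : ∀ x, (r ⁻¹' {x}).Finite) {f : ℕ → X → ℝ} {g : X → ℝ}
    (hf : ∀ x, Filter.Tendsto (fun n => f n x) Filter.atTop (nhds (g x)))
    (x : X) : Filter.Tendsto (fun n => transfer r (f n) x) Filter.atTop
      (nhds (transfer r g x)) := by
  have : Finite (r ⁻¹' {x}) := hfin x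
  have : Fintype (r ⁻¹' {x}) := Fintype.ofFinite _
  unfold transfer
  simp only [tsum_fintype]
  exact (tendsto_finsetSum (Finset.univ : Finset (r ⁻¹' {x})) fun i _ => hf (i : X)).const_mul _

lemma transfer_mul_comp (f g : X → ℝ) (x : X) :
    transfer r (fun y => g (r y) * f y) x = g x * transfer r f x := by
  unfold transfer
  have : (fun y : r ⁻¹' {x} => g (r y) * f y) = fun y : r ⁻¹' {x} => g x * f y := by
    funext y
    rw [show r y = x from y.2]
  rw [this, tsum_mul_left]
  ring

lemma ruelle_iter (W : X → ℝ) (n : ℕ) : ∀ f : X → ℝ, (ruelle r W)^[n] f =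
    (transfer r)^[n] (fun x => (∏ k ∈ Finset.range n, W (r^[k] x)) * f x) := by
  induction n with
  | zero => intro f; simp
  | succ n ih =>
    intro f
    rw [Function.iterate_succ_apply, ih, Function.iterate_succ_apply]
    congr 1
    funext x
    have := transfer_mul_comp (r := r) (fun y => W y * f y)
      (fun x => ∏ k ∈ Finset.range n, W (r^[k] x)) x
    rw [show ruelle r W f x = transfer r (fun y => W y * f y) x from rfl, ← this]
    congr 1
    funext y
    rw [Finset.prod_range_succ']
    simp only [Function.iterate_succ_apply, Function.iterate_zero, id]
    ring

variable [MeasurableSpace X] {μ : Measure X} [IsProbabilityMeasure μ]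

lemma transfer_integrable (hsur : Function.Surjective r) (hfin : ∀ x, (r ⁻¹' {x}).Finite)
    (hinv : StronglyInvariant r μ) {f : X → ℝ} (hf : BddMeasurable f) :
    Integrable (transfer r f) μ := by
  obtain ⟨hm, C, hC⟩ := hf
  have hfi : Integrable f μ :=
    Integrable.of_bound hm.aestronglyMeasurable C (Filter.Eventually.of_forall hC)
  set c : ℝ := 1 - ∫ x, f x ∂μ with hc
  have hb : BddMeasurable (fun y => f y + c) :=
    ⟨hm.add_const c, C + |c|, fun x => (abs_add_le _ _).trans (by gcongr; exact hC x)⟩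
  have h1 := hinv _ hb
  rw [integral_add hfi (integrable_const c)] at h1
  simp only [integral_const, probReal_univ, one_smul] at h1
  have h2 : Integrable (transfer r (fun y => f y + c)) μ := by
    by_contra hcon
    rw [integral_undef hcon] at h1
    linarith
  have h3 : transfer r f = fun x => transfer r (fun y => f y + c) x - c := by
    funext x
    rw [transfer_const_add hsur hfin]; ring
  rw [h3]
  exact h2.sub (integrable_const c)

lemma transfer_lintegral (hsur : Function.Surjective r) (hfin : ∀ x, (r ⁻¹' {x}).Finite)
    (hinv : StronglyInvariant r μ) {f : X → ℝ} (hf : Measurable f) (hf0 : ∀ x, 0 ≤ f x) :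
    AEMeasurable (transfer r f) μ ∧
      ∫⁻ x, ENNReal.ofReal (transfer r f x) ∂μ = ∫⁻ x, ENNReal.ofReal (f x) ∂μ := by
  let F : ℕ → X → ℝ := fun n x => min (f x) n
  have hF0 : ∀ n x, 0 ≤ F n x := fun n x => le_min (hf0 x) (Nat.cast_nonneg n)
  have hFb : ∀ n, BddMeasurable (F n) := fun n =>
    ⟨hf.min measurable_const, n, fun x => by
      rw [abs_of_nonneg (hF0 n x)]; exact min_le_right _ _⟩
  have hFt : ∀ x, Filter.Tendsto (fun n => F n x) Filter.atTop (nhds (f x)) := by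
    intro x
    refine tendsto_const_nhds.congr' ?_
    obtain ⟨N, hN⟩ := exists_nat_ge (f x)
    filter_upwards [Filter.eventually_ge_atTop N] with n hn
    exact (min_eq_left (hN.trans (by exact_mod_cast hn))).symm
  have hFm : ∀ x, Monotone fun n => F n x := fun x a b hab =>
    min_le_min le_rfl (by exact_mod_cast hab)
  have hTm := fun n => (transfer_integrable hsur hfin hinv (hFb n))
  have hTt := transfer_tendsto hfin hFt
  refine ⟨aemeasurable_of_tendsto_metrizable_ae Filter.atTop
    (fun n => (hTm n).aestronglyMeasurable.aemeasurable) (Filter.Eventually.of_forall hTt), ?_⟩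
  have e1 : Filter.Tendsto (fun n => ∫⁻ x, ENNReal.ofReal (F n x) ∂μ) Filter.atTop
      (nhds (∫⁻ x, ENNReal.ofReal (f x) ∂μ)) :=
    lintegral_tendsto_of_tendsto_of_monotone
      (fun n => (hFb n).1.ennreal_ofReal.aemeasurable)
      (Filter.Eventually.of_forall fun x a b hab => ENNReal.ofReal_le_ofReal (hFm x hab))
      (Filter.Eventually.of_forall fun x => ENNReal.tendsto_ofReal (hFt x))
  have e2 : Filter.Tendsto (fun n => ∫⁻ x, ENNReal.ofReal (transfer r (F n) x) ∂μ) Filter.atTop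
      (nhds (∫⁻ x, ENNReal.ofReal (transfer r f x) ∂μ)) :=
    lintegral_tendsto_of_tendsto_of_monotone
      (fun n => (hTm n).aestronglyMeasurable.aemeasurable.ennreal_ofReal)
      (Filter.Eventually.of_forall fun x a b hab => ENNReal.ofReal_le_ofReal
        (transfer_mono hfin (fun y => hFm y hab) x))
      (Filter.Eventually.of_forall fun x => ENNReal.tendsto_ofReal (hTt x))
  refine tendsto_nhds_unique e2 (e1.congr fun n => ?_)
  rw [← ofReal_integral_eq_lintegral_ofReal (hTm n)
    (Filter.Eventually.of_forall fun x => transfer_nonneg (hF0 n) x),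
    ← ofReal_integral_eq_lintegral_ofReal _ (Filter.Eventually.of_forall (hF0 n)), hinv _ (hFb n)]
  exact Integrable.of_bound (hFb n).1.aestronglyMeasurable n
    (Filter.Eventually.of_forall fun x => by
      rw [Real.norm_of_nonneg (hF0 n x)]; exact min_le_right _ _)

lemma transfer_congr_ae (hsur : Function.Surjective r) (hfin : ∀ x, (r ⁻¹' {x}).Finite)
    (hinv : StronglyInvariant r μ) {f g : X → ℝ} (hfg : f =ᵐ[μ] g) :
    transfer r f =ᵐ[μ] transfer r g := by
  let N := toMeasurable μ {x | f x ≠ g x}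
  have hN : μ N = 0 := by rw [measure_toMeasurable]; exact hfg
  have hNm : MeasurableSet N := measurableSet_toMeasurable _ _
  have hNs : {x | f x ≠ g x} ⊆ N := subset_toMeasurable _ _
  have h0 : ∀ x, 0 ≤ N.indicator (fun _ => (1 : ℝ)) x := fun x =>
    Set.indicator_nonneg (fun _ _ => zero_le_one) x
  obtain ⟨h1, h2⟩ := transfer_lintegral hsur hfin hinv
    (f := N.indicator fun _ => (1 : ℝ)) (measurable_const.indicator hNm) h0
  have h3 : ∫⁻ x, ENNReal.ofReal (N.indicator (fun _ => (1 : ℝ)) x) ∂μ = 0 := by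
    rw [lintegral_eq_zero_iff (measurable_const.indicator hNm).ennreal_ofReal]
    have : ∀ᵐ x ∂μ, x ∉ N := measure_eq_zero_iff_ae_notMem.1 hN
    filter_upwards [this] with x hx
    simp [hx]
  rw [h3, lintegral_eq_zero_iff' h1.ennreal_ofReal] at h2
  filter_upwards [h2] with x hx
  have : Finite (r ⁻¹' {x}) := hfin x
  have : Fintype (r ⁻¹' {x}) := Fintype.ofFinite _
  have hne : Nonempty (r ⁻¹' {x}) := by
    obtain ⟨y, hy⟩ := hsur x
    exact ⟨⟨y, hy⟩⟩
  have hc : (0 : ℝ) < (Nat.card (r ⁻¹' {x}) : ℝ) := by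
    exact_mod_cast Nat.card_pos
  have hx' : transfer r (N.indicator fun _ => (1 : ℝ)) x ≤ 0 := by
    simpa using hx
  unfold transfer at hx' ⊢
  rw [tsum_fintype] at hx'
  congr 1
  refine tsum_congr fun y => ?_
  by_contra hy
  have hyN : (y : X) ∈ N := hNs hy
  have : (1 : ℝ) ≤ ∑ b : r ⁻¹' {x}, N.indicator (fun _ => (1 : ℝ)) (b : X) := by
    have := Finset.single_le_sum (f := fun b : r ⁻¹' {x} => N.indicator (fun _ => (1 : ℝ)) (b : X))
      (fun i _ => h0 i) (Finset.mem_univ y)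
    simpa [hyN] using this
  have : 0 < (Nat.card (r ⁻¹' {x}) : ℝ)⁻¹ * ∑ b : r ⁻¹' {x}, N.indicator (fun _ => (1 : ℝ)) (b : X) :=
    mul_pos (inv_pos.2 hc) (by linarith)
  linarith

lemma transfer_lintegral_ae (hsur : Function.Surjective r) (hfin : ∀ x, (r ⁻¹' {x}).Finite)
    (hinv : StronglyInvariant r μ) {f : X → ℝ} (hf : AEMeasurable f μ) (hf0 : ∀ x, 0 ≤ f x) :
    AEMeasurable (transfer r f) μ ∧
      ∫⁻ x, ENNReal.ofReal (transfer r f x) ∂μ = ∫⁻ x, ENNReal.ofReal (f x) ∂μ := by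
  let g : X → ℝ := fun x => max (hf.mk f x) 0
  have hg : Measurable g := hf.measurable_mk.max measurable_const
  have hfg : f =ᵐ[μ] g := by
    filter_upwards [hf.ae_eq_mk] with x hx
    simp only [g, ← hx, max_eq_left (hf0 x)]
  have hT := transfer_congr_ae hsur hfin hinv hfg
  obtain ⟨h1, h2⟩ := transfer_lintegral hsur hfin hinv hg (fun x => le_max_right _ _)
  refine ⟨h1.congr hT.symm, ?_⟩
  have e1 : ∫⁻ x, ENNReal.ofReal (transfer r f x) ∂μ = ∫⁻ x, ENNReal.ofReal (transfer r g x) ∂μ :=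
    lintegral_congr_ae (hT.fun_comp ENNReal.ofReal)
  have e2 : ∫⁻ x, ENNReal.ofReal (f x) ∂μ = ∫⁻ x, ENNReal.ofReal (g x) ∂μ :=
    lintegral_congr_ae (hfg.fun_comp ENNReal.ofReal)
  rw [e1, h2, e2]

lemma transfer_iter (hsur : Function.Surjective r) (hfin : ∀ x, (r ⁻¹' {x}).Finite)
    (hinv : StronglyInvariant r μ) (n : ℕ) : ∀ {f : X → ℝ}, AEMeasurable f μ → (∀ x, 0 ≤ f x) →
    AEMeasurable ((transfer r)^[n] f) μ ∧ (∀ x, 0 ≤ (transfer r)^[n] f x) ∧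
      ∫⁻ x, ENNReal.ofReal ((transfer r)^[n] f x) ∂μ = ∫⁻ x, ENNReal.ofReal (f x) ∂μ := by
  induction n with
  | zero => intro f hf hf0; exact ⟨hf, hf0, rfl⟩
  | succ n ih =>
    intro f hf hf0
    obtain ⟨a, b⟩ := transfer_lintegral_ae hsur hfin hinv hf hf0
    obtain ⟨c, d, e⟩ := ih a (transfer_nonneg hf0)
    simp only [Function.iterate_succ, Function.comp]
    exact ⟨c, d, e.trans b⟩

lemma map_theta_eq (hr : Measurable r) (hsur : Function.Surjective r)
    (hfin : ∀ x, (r ⁻¹' {x}).Finite)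
    (hinv : StronglyInvariant r μ) {W : X → ℝ} (hW : Measurable W) (hW0 : ∀ x, 0 ≤ W x)
    {C : ℝ} (hWC : ∀ x, W x ≤ C) {h : X → ℝ} (hmeas : Measurable h) (hint : Integrable h μ)
    (hpos : ∀ x, 0 ≤ h x) (n : ℕ) {E : Set X} (hE : MeasurableSet E) :
    ENNReal.ofReal (∫ x, (ruelle r W)^[n] (E.indicator h) x ∂μ) =
      ∫⁻ x in E, ENNReal.ofReal ((∏ k ∈ Finset.range n, W (r^[k] x)) * h x) ∂μ := by
  rw [ruelle_iter]
  have hP : Measurable fun x => ∏ k ∈ Finset.range n, W (r^[k] x) :=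
    Finset.measurable_fun_prod _ fun k _ => hW.comp (hr.iterate k)
  have hP0 : ∀ x, 0 ≤ ∏ k ∈ Finset.range n, W (r^[k] x) := fun x =>
    Finset.prod_nonneg fun k _ => hW0 _
  have hPC : ∀ x, ∏ k ∈ Finset.range n, W (r^[k] x) ≤ C ^ n := fun x => by
    simpa using Finset.prod_le_prod (s := Finset.range n) (fun k _ => hW0 (r^[k] x))
      (fun k _ => hWC (r^[k] x))
  have hEm : Measurable (E.indicator h) := hmeas.indicator hE
  have hE0 : ∀ x, 0 ≤ E.indicator h x := fun x => Set.indicator_nonneg (fun y _ => hpos y) x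
  have hI : Integrable (fun x => (∏ k ∈ Finset.range n, W (r^[k] x)) * E.indicator h x) μ :=
    (hint.indicator hE).bdd_mul hP.aestronglyMeasurable (c := C ^ n)
      (Filter.Eventually.of_forall fun x => by rw [Real.norm_of_nonneg (hP0 x)]; exact hPC x)
  obtain ⟨a, b, c⟩ := transfer_iter (f := fun x => (∏ k ∈ Finset.range n, W (r^[k] x)) * E.indicator h x)
    hsur hfin hinv n (hP.mul hEm).aemeasurable
    (fun x => mul_nonneg (hP0 x) (hE0 x))
  rw [ofReal_integral_eq_lintegral_ofReal, c, ← lintegral_indicator hE]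
  · refine lintegral_congr fun x => ?_
    by_cases hx : x ∈ E <;> simp [hx]
  · refine ⟨a.aestronglyMeasurable, ?_⟩
    rw [hasFiniteIntegral_iff_ofReal (Filter.Eventually.of_forall b), c,
      ← hasFiniteIntegral_iff_ofReal (Filter.Eventually.of_forall fun x => mul_nonneg (hP0 x) (hE0 x))]
    exact hI.2
  · exact Filter.Eventually.of_forall b

end Transfer

section Ops

variable {Ω : Type} [MeasurableSpace Ω] {ν : Measure Ω}

lemma exists_mulOp (G : Ω → ℂ) (hG : Measurable G) (C : ℝ) (hC : ∀ x, ‖G x‖ ≤ C) :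
    ∃ M : Lp ℂ 2 ν →L[ℂ] Lp ℂ 2 ν, ∀ f : Lp ℂ 2 ν, ⇑(M f) =ᵐ[ν] fun x => G x * f x := by
  have hmem : ∀ f : Lp ℂ 2 ν, MemLp (fun x => G x * f x) 2 ν := fun f =>
    MemLp.of_le_mul (c := C) (Lp.memLp f)
      (hG.aestronglyMeasurable.mul (Lp.aestronglyMeasurable f))
      (Filter.Eventually.of_forall fun x => by
        rw [norm_mul]; exact mul_le_mul_of_nonneg_right (hC x) (norm_nonneg _))
  let L : Lp ℂ 2 ν →ₗ[ℂ] Lp ℂ 2 ν :=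
    { toFun := fun f => (hmem f).toLp _
      map_add' := fun f g => by
        apply Lp.ext
        filter_upwards [(hmem (f + g)).coeFn_toLp, (hmem f).coeFn_toLp, (hmem g).coeFn_toLp,
          Lp.coeFn_add f g, Lp.coeFn_add ((hmem f).toLp _) ((hmem g).toLp _)] with x h1 h2 h3 h4 h5
        rw [h1, h5, h4, Pi.add_apply, Pi.add_apply, h2, h3, mul_add]
      map_smul' := fun c f => by
        apply Lp.ext
        filter_upwards [(hmem (c • f)).coeFn_toLp, (hmem f).coeFn_toLp,
          Lp.coeFn_smul c f, Lp.coeFn_smul c ((hmem f).toLp _)] with x h1 h2 h4 h5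
        simp only [RingHom.id_apply]
        rw [h1, h5, h4, Pi.smul_apply, Pi.smul_apply, h2, smul_eq_mul, smul_eq_mul]; ring }
  refine ⟨L.mkContinuous C fun f => Lp.norm_le_mul_norm_of_ae_le_mul ?_, fun f => ?_⟩
  · filter_upwards [(hmem f).coeFn_toLp] with x h1
    change ‖((hmem f).toLp _ : Ω → ℂ) x‖ ≤ _
    rw [h1, norm_mul]
    exact mul_le_mul_of_nonneg_right (hC x) (norm_nonneg _)
  · exact (hmem f).coeFn_toLp

lemma exists_unitary (e : Ω ≃ᵐ Ω) (m : Ω → ℂ) (hm : Measurable m) (hm0 : ∀ᵐ x ∂ν, m x ≠ 0)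
    (hmap : (ν.withDensity fun x => ‖m x‖ₑ ^ 2).map e = ν) :
    Measure.QuasiMeasurePreserving e ν ν ∧
    ∃ U : Lp ℂ 2 ν ≃ₗᵢ[ℂ] Lp ℂ 2 ν, ∀ f : Lp ℂ 2 ν, ⇑(U f) =ᵐ[ν] fun x => m x * f (e x) := by
  have hdm : Measurable fun x => ‖m x‖ₑ ^ 2 := hm.enorm.pow_const 2
  have hac : ν ≪ ν.withDensity fun x => ‖m x‖ₑ ^ 2 :=
    withDensity_absolutelyContinuous' hdm.aemeasurable (by
      filter_upwards [hm0] with x hx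
      simpa using hx)
  have hq : Measure.QuasiMeasurePreserving e ν ν :=
    ⟨e.measurable, (hac.map e.measurable).trans (by rw [hmap])⟩
  have hq' : Measure.QuasiMeasurePreserving e.symm ν ν := by
    refine ⟨e.symm.measurable, ?_⟩
    have : ν.map e.symm = ν.withDensity fun x => ‖m x‖ₑ ^ 2 := by
      conv_lhs => rw [← hmap]
      rw [Measure.map_map e.symm.measurable e.measurable]
      simp
    rw [this]
    exact withDensity_absolutelyContinuous _ _
  have hlint : ∀ F : Ω → ℝ≥0∞, ∫⁻ x, ‖m x‖ₑ ^ 2 * F (e x) ∂ν = ∫⁻ x, F x ∂ν := by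
    intro F
    conv_rhs => rw [← hmap, lintegral_map_equiv]
    rw [lintegral_withDensity_eq_lintegral_mul_non_measurable _ hdm
      (Filter.Eventually.of_forall fun x => by finiteness)]
    rfl
  have hsq : ∀ F : Ω → ℂ, eLpNorm F 2 ν ^ (2 : ℝ) = ∫⁻ x, ‖F x‖ₑ ^ 2 ∂ν := by
    intro F
    have := eLpNorm_nnreal_pow_eq_lintegral (μ := ν) (f := F) (p := 2) (by norm_num)
    simpa using this
  have hnorm : ∀ F : Ω → ℂ, eLpNorm (fun x => m x * F (e x)) 2 ν = eLpNorm F 2 ν := by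
    intro F
    have : eLpNorm (fun x => m x * F (e x)) 2 ν ^ (2 : ℝ) = eLpNorm F 2 ν ^ (2 : ℝ) := by
      rw [hsq, hsq, ← hlint fun x => ‖F x‖ₑ ^ 2]
      simp only [enorm_mul, mul_pow]
    exact ENNReal.rpow_left_injective (by norm_num) this
  have hmem : ∀ f : Lp ℂ 2 ν, MemLp (fun x => m x * f (e x)) 2 ν := fun f =>
    ⟨hm.aestronglyMeasurable.mul ((Lp.aestronglyMeasurable f).comp_quasiMeasurePreserving hq),
      by rw [hnorm (f : Ω → ℂ)]; exact (Lp.memLp f).2⟩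
  let L : Lp ℂ 2 ν →ₗ[ℂ] Lp ℂ 2 ν :=
    { toFun := fun f => (hmem f).toLp _
      map_add' := fun f g => by
        apply Lp.ext
        filter_upwards [(hmem (f + g)).coeFn_toLp, (hmem f).coeFn_toLp, (hmem g).coeFn_toLp,
          hq.ae (Lp.coeFn_add f g),
          Lp.coeFn_add ((hmem f).toLp _) ((hmem g).toLp _)] with x h1 h2 h3 h4 h5
        rw [h1, h5, h4, Pi.add_apply, Pi.add_apply, h2, h3, mul_add]
      map_smul' := fun c f => by
        apply Lp.ext
        filter_upwards [(hmem (c • f)).coeFn_toLp, (hmem f).coeFn_toLp,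
          hq.ae (Lp.coeFn_smul c f), Lp.coeFn_smul c ((hmem f).toLp _)] with x h1 h2 h4 h5
        simp only [RingHom.id_apply]
        rw [h1, h5, h4, Pi.smul_apply, Pi.smul_apply, h2, smul_eq_mul, smul_eq_mul]; ring }
  let V : Lp ℂ 2 ν →ₗᵢ[ℂ] Lp ℂ 2 ν := ⟨L, fun f => by
    change ‖(hmem f).toLp _‖ = _
    rw [Lp.norm_toLp, hnorm (f : Ω → ℂ), Lp.norm_def]⟩
  have hV : ∀ f, ⇑(V f) =ᵐ[ν] fun x => m x * f (e x) := fun f => (hmem f).coeFn_toLp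
  have hsurj : Function.Surjective V := by
    intro g
    let F : Ω → ℂ := fun x => (m (e.symm x))⁻¹ * g (e.symm x)
    have hFe : (fun x => m x * F (e x)) =ᵐ[ν] g := by
      filter_upwards [hm0] with x hx
      simp [F, hx]
    have hF : MemLp F 2 ν := by
      refine ⟨((hm.comp e.symm.measurable).inv).aestronglyMeasurable.mul
        ((Lp.aestronglyMeasurable g).comp_quasiMeasurePreserving hq'), ?_⟩
      rw [← hnorm F, eLpNorm_congr_ae hFe]
      exact (Lp.memLp g).2
    refine ⟨hF.toLp F, Lp.ext ?_⟩
    filter_upwards [hV (hF.toLp F), hq.ae hF.coeFn_toLp, hFe] with x h1 h2 h3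
    rw [h1, h2, h3]
  exact ⟨hq, LinearIsometryEquiv.ofSurjective V hsurj, hV⟩

end Ops

section Solenoid

variable {X : Type} {r : X → X}

lemma theta_iter (n k : ℕ) (x : Xinf r) : r^[k] (theta r (n + k) x) = theta r n x := by
  induction k with
  | zero => rfl
  | succ k ih =>
    rw [Function.iterate_succ_apply, ← ih]
    congr 1
    exact x.2 (n + k)

lemma theta_zero_eq (n : ℕ) (x : Xinf r) : theta r 0 x = r^[n] (theta r n x) := by
  rw [← theta_iter 0 n x, Nat.zero_add]

lemma theta_rhat_succ (n : ℕ) (x : Xinf r) : theta r (n + 1) (rhat r x) = theta r n x := rfl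

lemma theta_rhat_zero (x : Xinf r) : theta r 0 (rhat r x) = r (theta r 0 x) := rfl

variable [MeasurableSpace X]

lemma measurable_theta (n : ℕ) : Measurable (theta r n) :=
  (measurable_pi_apply n).comp measurable_subtype_coe

/-- The automorphism `r̂` as a measurable equivalence. -/
def rhatEquiv (hr : Measurable r) : Xinf r ≃ᵐ Xinf r where
  toFun := rhat r
  invFun := fun x => ⟨fun n => (x : ℕ → X) (n + 1), fun n => x.2 (n + 1)⟩
  left_inv := fun x => by
    apply Subtype.ext
    funext n
    rfl
  right_inv := fun x => by
    apply Subtype.ext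
    funext n
    cases n with
    | zero => exact x.2 0
    | succ n => rfl
  measurable_toFun := by
    refine Measurable.subtype_mk (measurable_pi_iff.2 fun n => ?_)
    cases n with
    | zero => exact hr.comp (measurable_theta 0)
    | succ n => exact measurable_theta n
  measurable_invFun :=
    Measurable.subtype_mk (measurable_pi_iff.2 fun n => measurable_theta (n + 1))

/-- Cylinder sets. -/
def cyl (r : X → X) : Set (Set (Xinf r)) :=
  {S | ∃ (n : ℕ) (E : Set X), MeasurableSet E ∧ S = theta r n ⁻¹' E}

lemma cyl_gen : (inferInstance : MeasurableSpace (Xinf r)) =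
    MeasurableSpace.generateFrom (cyl r) := by
  apply le_antisymm
  · have h1 : @Measurable _ _ (MeasurableSpace.generateFrom (cyl r)) _
        (Subtype.val : Xinf r → ℕ → X) := by
      refine @measurable_pi_lambda _ _ _ (MeasurableSpace.generateFrom (cyl r)) _ _ fun n E hE => ?_
      exact MeasurableSpace.measurableSet_generateFrom ⟨n, E, hE, rfl⟩
    exact h1.comap_le
  · refine MeasurableSpace.generateFrom_le ?_
    rintro _ ⟨n, E, hE, rfl⟩
    exact measurable_theta n hE

lemma cyl_pi (hr : Measurable r) : IsPiSystem (cyl r) := by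
  have key : ∀ n k : ℕ, ∀ E F : Set X, MeasurableSet E → MeasurableSet F →
      theta r n ⁻¹' E ∩ theta r (n + k) ⁻¹' F ∈ cyl r := by
    intro n k E F hE hF
    refine ⟨n + k, r^[k] ⁻¹' E ∩ F, (hr.iterate k hE).inter hF, ?_⟩
    ext x
    simp [theta_iter]
  rintro _ ⟨n, E, hE, rfl⟩ _ ⟨m, F, hF, rfl⟩ -
  rcases le_total n m with h | h
  · obtain ⟨k, rfl⟩ := Nat.exists_eq_add_of_le h
    exact key n k E F hE hF
  · obtain ⟨k, rfl⟩ := Nat.exists_eq_add_of_le h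
    rw [Set.inter_comm]
    exact key m k F E hF hE

/-- A closed subspace of `L²` containing indicators of a generating π-system is everything. -/
lemma dense_of_cyl {Ω : Type} [mΩ : MeasurableSpace Ω] {ν : Measure Ω} [IsFiniteMeasure ν]
    (S : Submodule ℂ (Lp ℂ 2 ν)) (hS : IsClosed (S : Set (Lp ℂ 2 ν)))
    (D : Set (Set Ω)) (hgen : mΩ = MeasurableSpace.generateFrom D) (hpi : IsPiSystem D)
    (huniv : Set.univ ∈ D)
    (hD : ∀ s ∈ D, ∀ hs : MeasurableSet s,
      indicatorConstLp 2 hs (measure_ne_top ν s) (1 : ℂ) ∈ S) : S = ⊤ := by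
  have key : ∀ (s : Set Ω) (hs : MeasurableSet s),
      indicatorConstLp 2 hs (measure_ne_top ν s) (1 : ℂ) ∈ S := by
    refine MeasurableSpace.induction_on_inter hgen hpi ?_ ?_ ?_ ?_
    · rw [indicatorConstLp_empty]
      exact S.zero_mem
    · intro t ht
      exact hD t ht _
    · intro t ht hmem
      have h1 := S.sub_mem (hD _ huniv MeasurableSet.univ) hmem
      convert h1 using 1
      apply Lp.ext
      refine Filter.EventuallyEq.trans ?_ (Lp.coeFn_sub _ _).symm
      filter_upwards [indicatorConstLp_coeFn (p := 2) (hs := ht.compl) (hμs := measure_ne_top ν tᶜ)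
          (c := (1 : ℂ)),
        indicatorConstLp_coeFn (p := 2) (hs := ht) (hμs := measure_ne_top ν t)
          (c := (1 : ℂ)),
        indicatorConstLp_coeFn (p := 2) (hs := MeasurableSet.univ)
          (hμs := measure_ne_top ν Set.univ) (c := (1 : ℂ))] with x h1 h2 h3
      rw [Pi.sub_apply, h1, h2, h3]
      by_cases hx : x ∈ t <;> simp [hx]
    · intro f hd hfm hf
      have hAm : ∀ n, MeasurableSet (Set.accumulate f n) := fun n =>
        MeasurableSet.biUnion (Set.to_countable _) fun i _ => hfm i
      have hpart : ∀ n : ℕ, indicatorConstLp 2 (hAm n) (measure_ne_top ν _) (1 : ℂ) ∈ S := by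
        intro n
        induction n with
        | zero =>
          have := hf 0
          convert this using 2
          simp
        | succ n ih =>
          have hdis : Disjoint (Set.accumulate f n) (f (n + 1)) :=
            Set.disjoint_accumulate hd (Nat.lt_succ_self n)
          have h1 := S.add_mem ih (hf (n + 1))
          rw [← indicatorConstLp_disjoint_union (hAm n) (hfm (n + 1)) _ _ hdis] at h1
          convert h1 using 2
          rw [Set.accumulate_succ]
      have hsub : ∀ n, Set.accumulate f n ⊆ ⋃ i, f i := fun n => Set.accumulate_subset_iUnion n
      have ht : Filter.Tendsto (fun n => ν (symmDiff (Set.accumulate f n) (⋃ i, f i)))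
          Filter.atTop (nhds 0) := by
        have h1 : Filter.Tendsto (fun n => ν (Set.accumulate f n)) Filter.atTop
            (nhds (ν (⋃ i, f i))) := tendsto_measure_iUnion_accumulate
        have h2 := ENNReal.Tendsto.sub (tendsto_const_nhds (x := ν (⋃ i, f i))) h1
          (Or.inl (measure_ne_top _ _))
        rw [tsub_self] at h2
        refine h2.congr fun n => ?_
        rw [← measure_sdiff (hsub n) (hAm n).nullMeasurableSet (measure_ne_top _ _)]
        congr 1
        ext x
        simp only [Set.mem_symmDiff, Set.mem_sdiff]
        have := @hsub n x
        tauto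
      exact hS.mem_of_tendsto (tendsto_indicatorConstLp_set (by norm_num) ht)
        (Filter.Eventually.of_forall hpart)
  rw [eq_top_iff]
  intro f _
  refine Lp.induction (by norm_num) (motive := fun f => f ∈ S) ?_ ?_ hS f
  · intro c s hs hμs
    have h1 := S.smul_mem c (key s hs)
    convert h1 using 1
    rw [Lp.simpleFunc.coe_indicatorConst]
    apply Lp.ext
    refine Filter.EventuallyEq.trans ?_ (Lp.coeFn_smul _ _).symm
    filter_upwards [indicatorConstLp_coeFn (p := 2) (hs := hs) (hμs := hμs.ne)
          (c := c), indicatorConstLp_coeFn (p := 2) (hs := hs) (hμs := measure_ne_top ν s)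
          (c := (1 : ℂ))] with x h1 h2
    rw [Pi.smul_apply, h1, h2]
    by_cases hx : x ∈ s <;> simp [hx]
  · intro f g hf hg _ h1 h2
    exact S.add_mem h1 h2

end Solenoid

/-- Theorem 4.15: if `m₀` is non-singular, then `U f = m₀ (f ∘ r̂)` defines a unitary operator
on `L²(X_∞(r), μ̂)` and, together with the multiplication representation `π(g) f = (g∘θ₀) f`
and the vector `φ = 1`, it forms the covariant system associated to `m₀` and `h`; moreover
`U M_g U⁻¹ = M_{g ∘ r̂}` for every `g ∈ L^∞(X_∞(r), μ̂)`. -/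
theorem covariant_system_on_solenoid
    (X : Type) [MeasurableSpace X] (r : X → X) (hr : Measurable r)
    (hsur : Function.Surjective r) (hfin : ∀ x, (r ⁻¹' {x}).Finite)
    (μ : Measure X) [IsProbabilityMeasure μ] (hinv : StronglyInvariant r μ)
    (m₀ : X → ℂ) (hm₀ : BddMeasC m₀)
    (h : X → ℝ) (hmeas : Measurable h) (hint : Integrable h μ) (hpos : ∀ x, 0 ≤ h x)
    (hfix : ∀ᵐ x ∂μ, ruelle r (fun y => ‖m₀ y‖ ^ 2) h x = h x)
    (hns : μ {x | m₀ x = 0} = 0)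
    (μhat : Measure (Xinf r))
    (hμhat : ∀ (n : ℕ) (E : Set X), MeasurableSet E →
      μhat (theta r n ⁻¹' E) =
        ENNReal.ofReal (∫ x, (ruelle r fun y => ‖m₀ y‖ ^ 2)^[n] (E.indicator h) x ∂μ)) :
    ∃ (U : Lp ℂ 2 μhat ≃ₗᵢ[ℂ] Lp ℂ 2 μhat)
      (π : (X → ℂ) → (Lp ℂ 2 μhat →L[ℂ] Lp ℂ 2 μhat)) (φ : Lp ℂ 2 μhat),
      (∀ f : Lp ℂ 2 μhat,
        ⇑(U f) =ᵐ[μhat] fun xh => m₀ (theta r 0 xh) * f (rhat r xh)) ∧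
      (∀ g : X → ℂ, BddMeasC g → ∀ f : Lp ℂ 2 μhat,
        ⇑(π g f) =ᵐ[μhat] fun xh => g (theta r 0 xh) * f xh) ∧
      (⇑φ =ᵐ[μhat] fun _ => (1 : ℂ)) ∧
      (∀ g : X → ℂ, BddMeasC g → ∀ f : Lp ℂ 2 μhat, U (π g (U.symm f)) = π (g ∘ r) f) ∧
      (∀ g : X → ℂ, BddMeasC g → ⟪φ, π g φ⟫_ℂ = ∫ x, g x * (h x : ℂ) ∂μ) ∧
      U φ = π m₀ φ ∧
      Submodule.topologicalClosure (Submodule.span ℂ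
        {v : Lp ℂ 2 μhat | ∃ (n : ℕ) (g : X → ℂ), BddMeasC g ∧
          v = (⇑U.symm)^[n] (π g φ)}) = ⊤ ∧
      (∀ G : Xinf r → ℂ, Measurable G → (∃ C, ∀ xh, ‖G xh‖ ≤ C) →
        ∀ f fG : Lp ℂ 2 μhat, (⇑fG =ᵐ[μhat] fun xh => G xh * f xh) →
          ⇑(U fG) =ᵐ[μhat] fun xh => G (rhat r xh) * (U f) xh) := by
  obtain ⟨hm, C, hC⟩ := hm₀
  have hWm : Measurable fun y => ‖m₀ y‖ ^ 2 := hm.norm.pow_const 2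
  have hW0 : ∀ y, 0 ≤ ‖m₀ y‖ ^ 2 := fun y => by positivity
  have hWC : ∀ y, ‖m₀ y‖ ^ 2 ≤ C ^ 2 := fun y => pow_le_pow_left₀ (norm_nonneg _) (hC y) 2
  let d : ℕ → X → ℝ≥0∞ := fun n x =>
    ENNReal.ofReal ((∏ k ∈ Finset.range n, ‖m₀ (r^[k] x)‖ ^ 2) * h x)
  have hdm : ∀ n, Measurable (d n) := fun n =>
    ((Finset.measurable_fun_prod _ fun k _ => hWm.comp (hr.iterate k)).mul hmeas).ennreal_ofReal
  have hcyl : ∀ (n : ℕ) (E : Set X), MeasurableSet E →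
      μhat (theta r n ⁻¹' E) = ∫⁻ x in E, d n x ∂μ := fun n E hE => by
    rw [hμhat n E hE]
    exact map_theta_eq hr hsur hfin hinv hWm hW0 hWC hmeas hint hpos n hE
  have hmapθ : ∀ n, μhat.map (theta r n) = μ.withDensity (d n) := fun n => by
    ext E hE
    rw [Measure.map_apply (measurable_theta n) hE, withDensity_apply _ hE, hcyl n E hE]
  have hfinm : IsFiniteMeasure μhat := ⟨by
    have := hcyl 0 Set.univ MeasurableSet.univ
    rw [Set.preimage_univ] at this
    rw [this, Measure.restrict_univ]
    simpa [d] using hint.lintegral_lt_top⟩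
  let m : Xinf r → ℂ := fun x => m₀ (theta r 0 x)
  have hmm : Measurable m := hm.comp (measurable_theta 0)
  have hm0 : ∀ᵐ x ∂μhat, m x ≠ 0 := by
    have h1 : ∀ᵐ y ∂(μhat.map (theta r 0)), m₀ y ≠ 0 := by
      rw [hmapθ]
      refine (withDensity_absolutelyContinuous μ (d 0)).ae_le ?_
      change ∀ᵐ y ∂μ, m₀ y ≠ 0
      rw [ae_iff]
      simpa using hns
    exact ae_of_ae_map (measurable_theta 0).aemeasurable h1
  let e := rhatEquiv (r := r) hr
  have he : ∀ x, e x = rhat r x := fun x => rfl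
  have hcyl' : ∀ s ∈ cyl r, ∃ n E, MeasurableSet E ∧ s = theta r (n + 1) ⁻¹' E := by
    rintro s ⟨n, E, hE, rfl⟩
    refine ⟨n, r ⁻¹' E, hr hE, ?_⟩
    ext x
    change x.1 n ∈ E ↔ r (x.1 (n + 1)) ∈ E
    rw [x.2 n]
  have hcu : Set.univ ∈ cyl r := ⟨0, Set.univ, MeasurableSet.univ, rfl⟩
  have hcalc : ∀ s ∈ cyl r, μhat s = ((μhat.withDensity fun x => ‖m x‖ₑ ^ 2).map e) s := by
    intro s hs
    obtain ⟨n, E, hE, rfl⟩ := hcyl' s hs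
    have hS : MeasurableSet (theta r (n + 1) ⁻¹' E) := measurable_theta (n + 1) hE
    rw [Measure.map_apply e.measurable hS,
      withDensity_apply _ (e.measurable hS), hcyl (n + 1) E hE]
    have h1 : (e ⁻¹' (theta r (n + 1) ⁻¹' E)) = theta r n ⁻¹' E := rfl
    have h2 : (fun x => ‖m x‖ₑ ^ 2) = fun x => (fun y => ‖m₀ (r^[n] y)‖ₑ ^ 2) (theta r n x) := by
      funext x
      simp only [m]
      rw [theta_zero_eq n x]
    have h3 : Measurable fun y => ‖m₀ (r^[n] y)‖ₑ ^ 2 :=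
      (hm.comp (hr.iterate n)).enorm.pow_const 2
    rw [h1, h2, ← setLIntegral_map hE h3 (measurable_theta n), hmapθ,
      setLIntegral_withDensity_eq_setLIntegral_mul _ (hdm n) h3 hE]
    refine lintegral_congr fun x => ?_
    simp only [d, Pi.mul_apply]
    rw [Finset.prod_range_succ, ← ofReal_norm, ← ENNReal.ofReal_pow (norm_nonneg _),
      ← ENNReal.ofReal_mul (mul_nonneg (Finset.prod_nonneg fun k _ => hW0 _) (hpos x))]
    congr 1
    ring
  have hmap : (μhat.withDensity fun x => ‖m x‖ₑ ^ 2).map e = μhat :=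
    (ext_of_generate_finite (cyl r) cyl_gen (cyl_pi hr) hcalc (hcalc _ hcu)).symm
  obtain ⟨hq, U, hU⟩ := exists_unitary e m hmm hm0 hmap
  have hπ : ∀ g : X → ℂ, ∃ M : Lp ℂ 2 μhat →L[ℂ] Lp ℂ 2 μhat, BddMeasC g →
      ∀ f : Lp ℂ 2 μhat, ⇑(M f) =ᵐ[μhat] fun x => g (theta r 0 x) * f x := by
    intro g
    by_cases hg : BddMeasC g
    · obtain ⟨hgm, D, hD⟩ := hg
      obtain ⟨M, hM⟩ := exists_mulOp (ν := μhat) (fun x => g (theta r 0 x))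
        (hgm.comp (measurable_theta 0)) D (fun x => hD _)
      exact ⟨M, fun _ => hM⟩
    · exact ⟨0, fun hg' => absurd hg' hg⟩
  choose π hπ using hπ
  have h1mem : MemLp (fun _ : Xinf r => (1 : ℂ)) 2 μhat := memLp_const 1
  let φ : Lp ℂ 2 μhat := h1mem.toLp _
  have hφ : ⇑φ =ᵐ[μhat] fun _ => (1 : ℂ) := h1mem.coeFn_toLp
  have hiter : ∀ (n : ℕ) (v : Lp ℂ 2 μhat), ⇑((⇑U)^[n] v) =ᵐ[μhat]
      fun x => (∏ k ∈ Finset.range n, m₀ (r^[k] (theta r 0 x))) * v ((rhat r)^[n] x) := by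
    intro n v
    induction n with
    | zero => simp
    | succ n ih =>
      rw [Function.iterate_succ_apply']
      filter_upwards [hU ((⇑U)^[n] v), hq.ae ih] with x h1 h2
      rw [h1, h2, Finset.prod_range_succ', Function.iterate_succ_apply]
      simp only [he, theta_rhat_zero, Function.iterate_succ_apply, Function.iterate_zero, id, m]
      ring
  have hθi : ∀ (n : ℕ) (x : Xinf r), theta r n ((rhat r)^[n] x) = theta r 0 x := by
    intro n
    induction n with
    | zero => intro x; rfl
    | succ n ih =>
      intro x
      rw [Function.iterate_succ_apply', theta_rhat_succ, ih]
  refine ⟨U, π, φ, hU, fun g hg => hπ g hg, hφ, ?_, ?_, ?_, ?_, ?_⟩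
  · rintro g ⟨hgm, D, hD⟩ f
    have hg : BddMeasC g := ⟨hgm, D, hD⟩
    have hg' : BddMeasC (g ∘ r) := ⟨hgm.comp hr, D, fun x => hD _⟩
    obtain ⟨f, rfl⟩ := U.surjective f
    rw [U.symm_apply_apply]
    apply Lp.ext
    filter_upwards [hU (π g f), hq.ae (hπ g hg f), hπ _ hg' (U f), hU f] with x h1 h2 h3 h4
    rw [h1, h2, h3, h4]
    simp only [he, theta_rhat_zero, Function.comp]
    ring
  · intro g hg
    rw [L2.inner_def]
    have h1 : ∫ x, ⟪φ x, π g φ x⟫_ℂ ∂μhat = ∫ x, g (theta r 0 x) ∂μhat := by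
      refine integral_congr_ae ?_
      filter_upwards [hφ, hπ g hg φ] with x h1 h2
      rw [h2, h1]
      simp
    rw [h1, ← integral_map (measurable_theta 0).aemeasurable hg.1.aestronglyMeasurable, hmapθ,
      integral_withDensity_eq_integral_toReal_smul (hdm 0)
        (Filter.Eventually.of_forall fun x => ENNReal.ofReal_lt_top)]
    refine integral_congr_ae (Filter.Eventually.of_forall fun x => ?_)
    simp [d, ENNReal.toReal_ofReal (hpos x), mul_comm]
  · apply Lp.ext
    filter_upwards [hU φ, hπ m₀ ⟨hm, C, hC⟩ φ, hφ, hq.ae hφ] with x h1 h2 h3 h4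
    rw [h1, h2, h3, h4]
  · refine dense_of_cyl _ (Submodule.isClosed_topologicalClosure _) (cyl r) cyl_gen (cyl_pi hr)
      hcu ?_
    rintro _ ⟨n, E, hE, rfl⟩ hs
    refine Submodule.le_topologicalClosure _ (Submodule.subset_span ?_)
    let g : X → ℂ := fun y => (∏ k ∈ Finset.range n, m₀ (r^[k] y)) * E.indicator (fun _ => 1) y
    have hg : BddMeasC g := by
      refine ⟨(Finset.measurable_fun_prod _ fun k _ => hm.comp (hr.iterate k)).mul
        (measurable_const.indicator hE), C ^ n, fun y => ?_⟩
      have hp : ‖∏ k ∈ Finset.range n, m₀ (r^[k] y)‖ ≤ C ^ n := by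
        rw [norm_prod]
        simpa using Finset.prod_le_prod (s := Finset.range n)
          (fun k _ => norm_nonneg (m₀ (r^[k] y))) (fun k _ => hC (r^[k] y))
      by_cases hy : y ∈ E
      · simpa [g, hy] using hp
      · simpa [g, hy] using (norm_nonneg _).trans hp
    refine ⟨n, g, hg, ?_⟩
    have hleft : Function.LeftInverse ((⇑U.symm)^[n]) ((⇑U)^[n]) :=
      Function.LeftInverse.iterate U.symm_apply_apply n
    rw [← hleft (indicatorConstLp 2 hs (measure_ne_top μhat _) (1 : ℂ))]
    congr 1
    apply Lp.ext
    filter_upwards [hiter n (indicatorConstLp 2 hs (measure_ne_top μhat _) (1 : ℂ)),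
      hπ g hg φ, hφ, (hq.iterate n).ae (indicatorConstLp_coeFn (p := 2) (hs := hs)
        (hμs := measure_ne_top μhat _) (c := (1 : ℂ)))] with x h1 h2 h3 h4
    have h4' : (indicatorConstLp 2 hs (measure_ne_top μhat _) (1 : ℂ)) ((rhat r)^[n] x) =
      (theta r n ⁻¹' E).indicator (fun _ => (1 : ℂ)) ((rhat r)^[n] x) := h4
    rw [h1, h2, h3, h4']
    have h5 : (theta r n ⁻¹' E).indicator (fun _ => (1 : ℂ)) ((rhat r)^[n] x) =
        E.indicator (fun _ => (1 : ℂ)) (theta r 0 x) := by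
      rw [← hθi n x]
      rfl
    rw [h5]
    simp [g]
  · intro G hG _ f fG hfG
    filter_upwards [hU fG, hU f, hq.ae hfG] with x h1 h2 h3
    rw [h1, h2, h3]
    simp only [he]
    ring
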